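/- arXiv:1708.04235 — 2 statements merged into one kernel-verified Lean document; each statement's English description precedes it below -/
import Mathlib

section
/- Let f ∈ AC¹ and let (n_j) be a strictly increasing sequence of odd positive integers. Then lim_{j→∞} n_j · sup { |B_{n_j}(f,x) − f(x) − O(f,x)/D_{n_j}(x)| : x ∈ (−1,1), x not a node x_{k,n_j} } = 0. -/
open Filter Set MeasureTheory

noncomputable section

/-- Equally spaced nodes `x_{k,n} = 2k/n - 1`. -/
def node (n k : ℕ) : ℝ := 2 * k / n - 1

/-- `x` is one of the nodes `x_{0,n}, …, x_{n,n}`. -/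
def isNode (n : ℕ) (x : ℝ) : Prop := ∃ k ≤ n, x = node n k

/-- Denominator of Berrut's interpolant. -/
def Dden (n : ℕ) (x : ℝ) : ℝ :=
  ∑ k ∈ Finset.range (n + 1), (-1 : ℝ) ^ k / (x - node n k)

/-- Numerator of Berrut's interpolant. -/
def Nnum (f : ℝ → ℝ) (n : ℕ) (x : ℝ) : ℝ :=
  ∑ k ∈ Finset.range (n + 1), (-1 : ℝ) ^ k * f (node n k) / (x - node n k)

open Classical in
/-- Berrut's barycentric interpolant. -/
def berrut (f : ℝ → ℝ) (n : ℕ) (x : ℝ) : ℝ :=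
  if isNode n x then f x else Nnum f n x / Dden n x

/-- The odd bias function `O(f,x)`. -/
def Ofun (f : ℝ → ℝ) (x : ℝ) : ℝ :=
  (f x - f 1) / (2 * (x - 1)) - (f x - f (-1)) / (2 * (x + 1))

/-- The even bias function `E(f,x)`. -/
def Efun (f : ℝ → ℝ) (x : ℝ) : ℝ :=
  (f 1 - f x) / (2 * (x - 1)) + (f (-1) - f x) / (2 * (x + 1))

/-- `f` is differentiable on `[-1,1]` with absolutely continuous derivative. -/
def AC1 (f : ℝ → ℝ) : Prop :=
  ∃ f' : ℝ → ℝ,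
    (∀ x ∈ Set.Icc (-1 : ℝ) 1, HasDerivWithinAt f (f' x) (Set.Icc (-1 : ℝ) 1) x) ∧
    ∃ g : ℝ → ℝ, IntervalIntegrable g volume (-1) 1 ∧
      ∀ x ∈ Set.Icc (-1 : ℝ) 1, f' x = f' (-1) + ∫ t in (-1 : ℝ)..x, g t

/-- `x` is regular for the sequence `n j`: eventually never a node. -/
def Regular (n : ℕ → ℕ) (x : ℝ) : Prop := ∃ j₀, ∀ j ≥ j₀, ¬ isNode (n j) x

/-- The function `A(x) = Σ (-1)^k (4k+2)/((2k+1)^2 - x)`. -/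
def Afun (x : ℝ) : ℝ := ∑' k : ℕ, (-1 : ℝ) ^ k * (4 * k + 2) / ((2 * k + 1) ^ 2 - x)

/-- `ι_n(x) = ⌊n(x+1)/2⌋`. -/
def iota (n : ℕ) (x : ℝ) : ℤ := ⌊(n : ℝ) * (x + 1) / 2⌋

/-- `ρ_n(x) = n(x - x_{ι_n(x),n}) - 1 = n(x+1) - 2 ι_n(x) - 1`. -/
def rho (n : ℕ) (x : ℝ) : ℝ := (n : ℝ) * (x + 1) - 2 * (iota n x : ℝ) - 1

open Classical in
/-- The de-biased numerator `Δ_n(f,x)`. -/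
def Delta (f : ℝ → ℝ) (n : ℕ) (x : ℝ) : ℝ :=
  if isNode n x then 0 else
    (f (-1) - f x) / (2 * (x + 1)) + (-1 : ℝ) ^ n * (f 1 - f x) / (2 * (x - 1)) +
      (1 / (n : ℝ)) * ∑ k ∈ Finset.Ioo 0 n, (-1 : ℝ) ^ k * (f (node n k) - f x) / (x - node n k)

end

noncomputable section

def sl (f : ℝ → ℝ) (x t : ℝ) : ℝ := (f t - f x) / (t - x)

def Lf (f : ℝ → ℝ) (n : ℕ) (x : ℝ) : ℝ :=
  ∑ k ∈ Finset.range n, (-1 : ℝ) ^ k * (sl f x (node n (k + 1)) - sl f x (node n k))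

lemma alt_bounds (m : ℕ) : ∀ a : ℕ → ℝ, Antitone a → (∀ k, 0 ≤ a k) →
    0 ≤ ∑ k ∈ Finset.range m, (-1 : ℝ) ^ k * a k ∧
      ∑ k ∈ Finset.range m, (-1 : ℝ) ^ k * a k ≤ a 0 := by
  induction m with
  | zero => intro a _ h; simpa using h 0
  | succ m ih =>
    intro a ha h
    obtain ⟨h1, h2⟩ := ih (fun k => a (k + 1)) (fun i j hij => ha (by omega)) (fun k => h _)
    have e : ∑ k ∈ Finset.range (m + 1), (-1 : ℝ) ^ k * a k
        = a 0 - ∑ k ∈ Finset.range m, (-1 : ℝ) ^ k * a (k + 1) := by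
      rw [Finset.sum_range_succ']
      simp only [pow_succ, mul_neg, mul_one, neg_mul, Finset.sum_neg_distrib]
      ring
    have := ha (Nat.zero_le 1)
    simp only [zero_add] at h2
    rw [e]; constructor <;> linarith

lemma alt_lower (m : ℕ) (a : ℕ → ℝ) (ha : Antitone a) (h : ∀ k, 0 ≤ a k) :
    a 0 - a 1 ≤ ∑ k ∈ Finset.range (m + 1), (-1 : ℝ) ^ k * a k := by
  obtain ⟨h1, h2⟩ := alt_bounds m (fun k => a (k + 1)) (fun i j hij => ha (by omega)) (fun k => h _)
  have e : ∑ k ∈ Finset.range (m + 1), (-1 : ℝ) ^ k * a k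
      = a 0 - ∑ k ∈ Finset.range m, (-1 : ℝ) ^ k * a (k + 1) := by
    rw [Finset.sum_range_succ']
    simp only [pow_succ, mul_neg, mul_one, neg_mul, Finset.sum_neg_distrib]
    ring
  simp only [zero_add] at h2
  rw [e]; linarith

lemma Dden_lower (n : ℕ) (hn : 0 < n) (x : ℝ) (hx : x ∈ Set.Ioo (-1 : ℝ) 1)
    (hnode : ¬ isNode n x) : (n : ℝ) / 4 ≤ |Dden n x| := by
  have hn' : (0 : ℝ) < n := by exact_mod_cast hn
  obtain ⟨h1, h2⟩ := hx
  set y : ℝ := (n : ℝ) * (x + 1) / 2 with hy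
  have hy0 : 0 ≤ y := by rw [hy]; apply div_nonneg (mul_nonneg hn'.le (by linarith)) (by norm_num)
  have hyn : y < n := by rw [hy]; nlinarith
  set i := ⌊y⌋₊ with hi
  have hi1 : (i : ℝ) ≤ y := Nat.floor_le hy0
  have hi2 : y < i + 1 := Nat.lt_floor_add_one y
  have hin : i < n := by exact_mod_cast hi1.trans_lt hyn
  set h : ℝ := 2 / n with hh
  have hpos : 0 < h := by positivity
  have hxy : x = h * y - 1 := by rw [hy, hh]; field_simp; ring
  have hnd : ∀ k : ℕ, node n k = h * k - 1 := by intro k; rw [node, hh]; ring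
  have hne : ∀ k ≤ n, x ≠ node n k := fun k hk e => hnode ⟨k, hk, e⟩
  have hi1' : (i : ℝ) < y := by
    rcases hi1.lt_or_eq with h | h
    · exact h
    · exact absurd (by rw [hnd, hxy, h]) (hne i hin.le)
  set α := h * (y - i) with hα
  set β := h * (i + 1 - y) with hβ
  have hα0 : 0 < α := mul_pos hpos (by linarith)
  have hβ0 : 0 < β := mul_pos hpos (by linarith)
  have hαh : α ≤ h := by rw [hα]; nlinarith
  have anti : ∀ γ : ℝ, 0 < γ → Antitone (fun k : ℕ => 1 / (γ + h * k)) := by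
    intro γ hγ a b hab
    have : (a : ℝ) ≤ b := by exact_mod_cast hab
    have : 0 < γ + h * a := by positivity
    apply one_div_le_one_div_of_le this
    gcongr
  have nonneg : ∀ γ : ℝ, 0 < γ → ∀ k : ℕ, 0 ≤ 1 / (γ + h * k) := by
    intro γ hγ k; positivity
  have e : Dden n x = (-1 : ℝ) ^ i * (∑ k ∈ Finset.range (i + 1), (-1 : ℝ) ^ k * (1 / (α + h * k))
      + ∑ k ∈ Finset.range (n - i), (-1 : ℝ) ^ k * (1 / (β + h * k))) := by
    have : n + 1 = (i + 1) + (n - i) := by omega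
    rw [Dden, this, Finset.sum_range_add, mul_add, Finset.mul_sum, Finset.mul_sum]
    congr 1
    · rw [← Finset.sum_range_reflect]
      apply Finset.sum_congr rfl
      intro k hk
      have hk' : k ≤ i := by simpa [Nat.lt_succ_iff] using hk
      have e1 : i + 1 - 1 - k = i - k := by omega
      have e2 : (-1 : ℝ) ^ i = (-1) ^ (i - k) * (-1) ^ k := by
        rw [← pow_add]; congr 1; omega
      have e3 : (-1 : ℝ) ^ k * (-1) ^ k = 1 := by rw [← mul_pow]; simp
      have e4 : x - node n (i - k) = α + h * k := by
        rw [hnd, hxy, Nat.cast_sub hk', hα]; ring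
      rw [e1, e4, e2, div_eq_mul_one_div]
      linear_combination (-(-1 : ℝ) ^ (i - k) * (1 / (α + h * k))) * e3
    · apply Finset.sum_congr rfl
      intro k hk
      have e4 : x - node n (i + 1 + k) = - (β + h * k) := by
        rw [hnd, hxy, hβ]; push_cast; ring
      rw [e4, div_neg, pow_add, pow_add]; ring
  have b1 := alt_lower i _ (anti α hα0) (nonneg α hα0)
  have b2 := (alt_bounds (n - i) _ (anti β hβ0) (nonneg β hβ0)).1
  have b3 : (n : ℝ) / 4 ≤ 1 / (α + h * (0 : ℕ)) - 1 / (α + h * (1 : ℕ)) := by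
    have : 1 / (α + h * (0 : ℕ)) - 1 / (α + h * (1 : ℕ)) = h / (α * (α + h)) := by
      push_cast
      have : α + h ≠ 0 := by positivity
      have : α ≠ 0 := by positivity
      rw [mul_zero, add_zero, mul_one]
      field_simp; ring
    rw [this]
    have : (n : ℝ) / 4 = h / (h * (h + h)) := by rw [hh]; field_simp; norm_num
    rw [this]
    gcongr
  rw [e, abs_mul, abs_pow, abs_neg, abs_one, one_pow, one_mul]
  exact (b3.trans (b1.trans (by linarith))).trans (le_abs_self _)

lemma num_identity (f : ℝ → ℝ) (n : ℕ) (hn : 0 < n) (ho : Odd n) (x : ℝ) (hnode : ¬ isNode n x) :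
    Nnum f n x - f x * Dden n x - Ofun f x = (1 / 2) * Lf f n x := by
  have hn' : (n : ℝ) ≠ 0 := by positivity
  have hne : ∀ k ≤ n, x - node n k ≠ 0 := fun k hk e => hnode ⟨k, hk, by linarith⟩
  have n0 : node n 0 = -1 := by simp [node]
  have nn : node n n = 1 := by rw [node]; field_simp; norm_num
  have h1 : Nnum f n x - f x * Dden n x
      = - ∑ k ∈ Finset.range (n + 1), (-1 : ℝ) ^ k * sl f x (node n k) := by
    rw [Nnum, Dden, Finset.mul_sum, ← Finset.sum_sub_distrib, ← Finset.sum_neg_distrib]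
    apply Finset.sum_congr rfl
    intro k hk
    have := hne k (by simpa [Nat.lt_succ_iff] using hk)
    have h' : node n k - x ≠ 0 := fun e => this (by linarith)
    rw [sl, ← neg_sub x (node n k), div_neg]
    field_simp
  have h2 : Ofun f x = (sl f x 1 - sl f x (-1)) / 2 := by
    have a := hne 0 (by omega)
    have b := hne n le_rfl
    rw [n0] at a; rw [nn] at b
    have a' : x + 1 ≠ 0 := by intro e; apply a; linarith
    have b' : 1 - x ≠ 0 := by intro e; apply b; linarith
    have c' : -1 - x ≠ 0 := by intro e; apply a; linarith
    rw [Ofun, sl, sl, show (-1 - x : ℝ) = -(x + 1) by ring, show (1 - x : ℝ) = -(x - 1) by ring,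
      div_neg, div_neg]
    field_simp; ring
  have h3 : ∀ (s : ℕ → ℝ) (m : ℕ), ∑ k ∈ Finset.range m, (-1 : ℝ) ^ k * (s (k + 1) - s k)
      = - 2 * ∑ k ∈ Finset.range (m + 1), (-1 : ℝ) ^ k * s k + s 0 + (-1) ^ m * s m := by
    intro s m
    induction m with
    | zero => simp; ring
    | succ m ih => rw [Finset.sum_range_succ, ih, Finset.sum_range_succ _ (m + 1)]; ring
  have h4 := h3 (fun k => sl f x (node n k)) n
  simp only [ho.neg_one_pow, n0, nn] at h4
  rw [h1, h2, Lf, h4]; ring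

lemma alt_small (A δ : ℝ) (hA : 0 ≤ A) (a : ℕ → ℝ) (n : ℕ) :
    (∀ k < n, |a k| ≤ A) → (∀ k, k + 1 < n → |a (k + 1) - a k| ≤ δ) →  0 ≤ δ →
    |∑ k ∈ Finset.range n, (-1 : ℝ) ^ k * a k| ≤ A + n * δ := by
  induction n using Nat.twoStepInduction with
  | zero => intro _ _ _; simpa using hA
  | one => intro h _ hδ; have := h 0 (by omega); simp; linarith
  | more n ih _ =>
    intro h1 h2 hδ
    have := ih (fun k hk => h1 k (by omega)) (fun k hk => h2 k (by omega)) hδ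
    have h3 := h2 n (by omega)
    rw [Finset.sum_range_succ, Finset.sum_range_succ]
    have e : ∑ k ∈ Finset.range n, (-1 : ℝ) ^ k * a k + (-1) ^ n * a n + (-1) ^ (n + 1) * a (n + 1)
       = ∑ k ∈ Finset.range n, (-1 : ℝ) ^ k * a k + (-((-1) ^ n * (a (n + 1) - a n))) := by ring
    rw [e]
    refine (abs_add_le _ _).trans ?_
    rw [abs_neg, abs_mul, abs_pow, abs_neg, abs_one, one_pow, one_mul]
    push_cast
    linarith

lemma node_mem (n k : ℕ) (hn : 0 < n) (hk : k ≤ n) : node n k ∈ Set.Icc (-1 : ℝ) 1 := by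
  have hn' : (0 : ℝ) < n := by exact_mod_cast hn
  have hk' : (k : ℝ) ≤ n := by exact_mod_cast hk
  have h1 : (0 : ℝ) ≤ 2 * k / n := by positivity
  have h2 : (2 * k / n : ℝ) ≤ 2 := by rw [div_le_iff₀ hn']; linarith
  rw [node]; constructor <;> linarith

lemma node_succ (n k : ℕ) : node n (k + 1) - node n k = 2 / n := by
  simp only [node]; push_cast; ring

lemma node_lt (n k : ℕ) (hn : 0 < n) : node n k < node n (k + 1) := by
  have := node_succ n k
  have hn' : (0 : ℝ) < n := by exact_mod_cast hn
  have : (0 : ℝ) < 2 / n := by positivity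
  linarith

lemma pow_diff (i : ℕ) (a b : ℝ) (ha : a ∈ Set.Icc (-1 : ℝ) 1) (hb : b ∈ Set.Icc (-1 : ℝ) 1) :
    |a ^ i - b ^ i| ≤ i * |a - b| := by
  refine (abs_pow_sub_pow_le a b i).trans ?_
  have h1 : max |a| |b| ≤ 1 := max_le (abs_le.2 ha) (abs_le.2 hb)
  have h2 : (max |a| |b|) ^ (i - 1) ≤ 1 := pow_le_one₀ (by positivity) h1
  calc |a - b| * i * (max |a| |b|) ^ (i - 1) ≤ |a - b| * i * 1 := by gcongr
    _ = _ := by ring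

lemma pow_alt (i n : ℕ) (hn : 0 < n) :
    |∑ k ∈ Finset.range n, (-1 : ℝ) ^ k * (node n (k + 1) ^ i - node n k ^ i)|
      ≤ (2 * i + 8 * i ^ 2) / n := by
  have hn' : (0 : ℝ) < n := by exact_mod_cast hn
  have key : ∀ k < n, ∃ c ∈ Set.Ioo (node n k) (node n (k + 1)),
      node n (k + 1) ^ i - node n k ^ i = 2 / n * (i * c ^ (i - 1)) := by
    intro k hk
    obtain ⟨c, hc, e⟩ := exists_hasDerivAt_eq_slope (fun t : ℝ => t ^ i)
      (fun t => (i : ℝ) * t ^ (i - 1)) (node_lt n k hn) (by fun_prop)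
      (fun t _ => hasDerivAt_pow i t)
    refine ⟨c, hc, ?_⟩
    rw [node_succ, eq_div_iff (by positivity)] at e
    linarith
  refine (alt_small (i * (2 / n)) (2 / n * (i * (i * (2 * (2 / n))))) (by positivity)
    (fun k => node n (k + 1) ^ i - node n k ^ i) n ?_ ?_ (by positivity)).trans (le_of_eq ?_)
  · intro k hk
    refine (pow_diff i _ _ (node_mem n _ hn hk) (node_mem n _ hn hk.le)).trans ?_
    rw [node_succ, abs_of_pos (by positivity)]
  · intro k hk
    obtain ⟨c, hc, e⟩ := key k (by omega)
    obtain ⟨d, hd, e'⟩ := key (k + 1) hk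
    rw [e, e', ← mul_sub, ← mul_sub, abs_mul, abs_mul, abs_of_pos (by positivity : (0 : ℝ) < 2 / n),
      Nat.abs_cast]
    have m0 := node_mem n k hn (by omega)
    have m1 := node_mem n (k + 1) hn (by omega)
    have m2 := node_mem n (k + 1 + 1) hn (by omega)
    have s0 := node_succ n k
    have s1 := node_succ n (k + 1)
    have p := pow_diff (i - 1) d c ⟨by linarith [hd.1, m1.1], by linarith [hd.2, m2.2]⟩
      ⟨by linarith [hc.1, m0.1], by linarith [hc.2, m1.2]⟩
    have q : |d - c| ≤ 2 * (2 / n) := by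
      rw [abs_le]; constructor <;> linarith [hc.1, hc.2, hd.1, hd.2]
    have r : ((i - 1 : ℕ) : ℝ) ≤ i := by exact_mod_cast Nat.sub_le i 1
    gcongr
    refine p.trans ?_
    gcongr
  · field_simp; ring

lemma Lf_add (f g : ℝ → ℝ) (n : ℕ) (x : ℝ) :
    Lf (fun t => f t + g t) n x = Lf f n x + Lf g n x := by
  simp only [Lf, ← Finset.sum_add_distrib, sl]
  apply Finset.sum_congr rfl
  intros; ring

lemma Lf_smul (c : ℝ) (f : ℝ → ℝ) (n : ℕ) (x : ℝ) :
    Lf (fun t => c * f t) n x = c * Lf f n x := by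
  simp only [Lf, Finset.mul_sum, sl]
  apply Finset.sum_congr rfl
  intros; ring

lemma Lf_pow (m n : ℕ) (hn : 0 < n) (x : ℝ) (hx : x ∈ Set.Ioo (-1 : ℝ) 1)
    (hnode : ¬ isNode n x) :
    |Lf (fun t => t ^ m) n x| ≤ (∑ i ∈ Finset.range m, (2 * (i : ℝ) + 8 * i ^ 2)) / n := by
  have hs : ∀ k ≤ n, sl (fun t => t ^ m) x (node n k)
      = ∑ i ∈ Finset.range m, x ^ (m - 1 - i) * node n k ^ i := by
    intro k hk
    have : node n k - x ≠ 0 := fun e => hnode ⟨k, hk, by linarith⟩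
    rw [sl, div_eq_iff this, ← (Commute.all (node n k) x).geom_sum₂_mul]
    congr 1
    apply Finset.sum_congr rfl
    intros; ring
  have e : Lf (fun t => t ^ m) n x = ∑ i ∈ Finset.range m, x ^ (m - 1 - i) *
      ∑ k ∈ Finset.range n, (-1 : ℝ) ^ k * (node n (k + 1) ^ i - node n k ^ i) := by
    simp only [Finset.mul_sum]
    rw [Lf, Finset.sum_comm]
    apply Finset.sum_congr rfl
    intro k hk
    have hk' := Finset.mem_range.1 hk
    rw [hs _ hk', hs _ hk'.le, ← Finset.sum_sub_distrib, Finset.mul_sum]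
    apply Finset.sum_congr rfl
    intros; ring
  rw [e, Finset.sum_div]
  refine (Finset.abs_sum_le_sum_abs _ _).trans (Finset.sum_le_sum fun i _ => ?_)
  rw [abs_mul, abs_pow]
  have h1 : |x| ^ (m - 1 - i) ≤ 1 :=
    pow_le_one₀ (abs_nonneg _) (abs_le.2 ⟨hx.1.le, hx.2.le⟩)
  calc _ ≤ 1 * |∑ k ∈ Finset.range n, (-1 : ℝ) ^ k * (node n (k + 1) ^ i - node n k ^ i)| := by
        gcongr
    _ ≤ _ := by rw [one_mul]; exact pow_alt i n hn

lemma Lf_poly (p : Polynomial ℝ) : ∃ C : ℝ, 0 ≤ C ∧ ∀ n : ℕ, 0 < n → ∀ x ∈ Set.Ioo (-1 : ℝ) 1,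
    ¬ isNode n x → |Lf (fun t => p.eval t) n x| ≤ C / n := by
  induction p using Polynomial.induction_on' with
  | add p q hp hq =>
    obtain ⟨C, hC0, hC⟩ := hp
    obtain ⟨D, hD0, hD⟩ := hq
    refine ⟨C + D, by positivity, fun n hn x hx hnode => ?_⟩
    simp only [Polynomial.eval_add]
    rw [Lf_add, add_div]
    exact (abs_add_le _ _).trans (add_le_add (hC n hn x hx hnode) (hD n hn x hx hnode))
  | monomial m a =>
    refine ⟨|a| * (∑ i ∈ Finset.range m, (2 * (i : ℝ) + 8 * i ^ 2)), by positivity,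
      fun n hn x hx hnode => ?_⟩
    simp only [Polynomial.eval_monomial]
    rw [Lf_smul, abs_mul, mul_div_assoc]
    gcongr
    exact Lf_pow m n hn x hx hnode

lemma poly_antideriv (p : Polynomial ℝ) : ∃ q : Polynomial ℝ, Polynomial.derivative q = p := by
  induction p using Polynomial.induction_on' with
  | add p q hp hq =>
    obtain ⟨a, rfl⟩ := hp
    obtain ⟨b, rfl⟩ := hq
    exact ⟨a + b, by simp⟩
  | monomial m a =>
    refine ⟨Polynomial.monomial (m + 1) (a / (m + 1)), ?_⟩
    have : (m : ℝ) + 1 ≠ 0 := by positivity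
    rw [Polynomial.derivative_monomial]
    simp [this]

lemma poly_dense (g : ℝ → ℝ) (hg : IntervalIntegrable g volume (-1) 1) (ε : ℝ) (hε : 0 < ε) :
    ∃ p : Polynomial ℝ, ∫ t in (-1 : ℝ)..1, |g t - p.eval t| ≤ ε := by
  have h11 : (-1 : ℝ) ≤ 1 := by norm_num
  have hg' : Integrable g (volume.restrict (Set.Ioc (-1 : ℝ) 1)) :=
    (intervalIntegrable_iff_integrableOn_Ioc_of_le h11).1 hg
  obtain ⟨c, -, hc1, hc2, -⟩ := hg'.exists_hasCompactSupport_integral_sub_le (half_pos hε)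
  obtain ⟨p, hp⟩ := exists_polynomial_near_of_continuousOn (-1) 1 c hc2.continuousOn (ε / 4)
    (by positivity)
  refine ⟨p, ?_⟩
  have hcI : IntervalIntegrable c volume (-1) 1 := hc2.intervalIntegrable _ _
  have hpc : Continuous fun t => p.eval t := p.continuous
  have hpI : IntervalIntegrable (fun t => p.eval t) volume (-1) 1 := hpc.intervalIntegrable _ _
  have i1 := (hg.sub hcI).abs
  have i2 := (hcI.sub hpI).abs
  have hc1' : ∫ t in (-1 : ℝ)..1, |g t - c t| ≤ ε / 2 := by
    rw [intervalIntegral.integral_of_le h11]; exact hc1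
  have hp' : ∫ t in (-1 : ℝ)..1, |c t - p.eval t| ≤ ε / 2 := by
    have := intervalIntegral.integral_mono_on h11 i2
      (intervalIntegrable_const (c := ε / 4)) (fun x hx => by
        have := (hp x hx).le; rw [abs_sub_comm] at this; exact this)
    refine this.trans (le_of_eq ?_)
    simp; ring
  calc ∫ t in (-1 : ℝ)..1, |g t - p.eval t|
      ≤ ∫ t in (-1 : ℝ)..1, (|g t - c t| + |c t - p.eval t|) :=
        intervalIntegral.integral_mono_on h11 (hg.sub hpI).abs (i1.add i2)
          (fun x _ => abs_sub_le _ _ _)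
    _ = (∫ t in (-1 : ℝ)..1, |g t - c t|) + ∫ t in (-1 : ℝ)..1, |c t - p.eval t| :=
        intervalIntegral.integral_add i1 i2
    _ ≤ ε := by linarith

lemma convex_aux (F F' : ℝ → ℝ)
    (hF : ∀ x ∈ Set.Icc (-1 : ℝ) 1, HasDerivWithinAt F (F' x) (Set.Icc (-1 : ℝ) 1) x)
    (hm : MonotoneOn F' (Set.Icc (-1 : ℝ) 1)) : ConvexOn ℝ (Set.Icc (-1 : ℝ) 1) F := by
  have hd : ∀ x ∈ Set.Ioo (-1 : ℝ) 1, HasDerivAt F (F' x) x := fun x hx =>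
    (hF x (Set.Ioo_subset_Icc_self hx)).hasDerivAt (Icc_mem_nhds hx.1 hx.2)
  apply MonotoneOn.convexOn_of_deriv (convex_Icc _ _)
  · exact fun x hx => (hF x hx).continuousWithinAt
  · rw [interior_Icc]
    exact fun x hx => (hd x hx).differentiableAt.differentiableWithinAt
  · rw [interior_Icc]
    intro a ha b hb hab
    rw [(hd a ha).deriv, (hd b hb).deriv]
    exact hm (Set.Ioo_subset_Icc_self ha) (Set.Ioo_subset_Icc_self hb) hab

lemma Lf_var (R R' g : ℝ → ℝ)
    (hR : ∀ x ∈ Set.Icc (-1 : ℝ) 1, HasDerivWithinAt R (R' x) (Set.Icc (-1 : ℝ) 1) x)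
    (hg : IntervalIntegrable g volume (-1) 1)
    (hR' : ∀ x ∈ Set.Icc (-1 : ℝ) 1, R' x = R' (-1) + ∫ t in (-1 : ℝ)..x, g t)
    (n : ℕ) (hn : 0 < n) (x : ℝ) (hx : x ∈ Set.Ioo (-1 : ℝ) 1) (hnode : ¬ isNode n x) :
    |Lf R n x| ≤ ∫ t in (-1 : ℝ)..1, |g t| := by
  have h11 : (-1 : ℝ) ≤ 1 := by norm_num
  have hgI : IntegrableOn g (Set.Icc (-1 : ℝ) 1) := by
    rw [integrableOn_Icc_iff_integrableOn_Ioc]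
    exact (intervalIntegrable_iff_integrableOn_Ioc_of_le h11).1 hg
  set G : ℝ → ℝ := Set.indicator (Set.Icc (-1 : ℝ) 1) (fun t => |g t|) with hG
  have hGI : Integrable G := (integrable_indicator_iff measurableSet_Icc).2 hgI.abs
  have hGII : ∀ a b, IntervalIntegrable G volume a b := fun a b => hGI.intervalIntegrable
  have hG0 : ∀ t, 0 ≤ G t := fun t => Set.indicator_nonneg (fun _ _ => abs_nonneg _) t
  have hGe : ∀ t ∈ Set.Icc (-1 : ℝ) 1, G t = |g t| := fun t ht => Set.indicator_of_mem ht _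
  set φ : ℝ → ℝ := fun y => ∫ t in (-1 : ℝ)..y, G t with hφ
  have hφc : Continuous φ := intervalIntegral.continuous_primitive hGII (-1)
  have hφs : ∀ a b, φ b - φ a = ∫ t in a..b, G t := fun a b =>
    intervalIntegral.integral_interval_sub_left (hGII _ _) (hGII _ _)
  have hφm : Monotone φ := by
    intro a b hab
    have := intervalIntegral.integral_nonneg_of_forall (μ := volume) hab hG0
    linarith [hφs a b]
  have hφ0 : φ (-1) = 0 := by simp [hφ]
  have hφ1 : φ 1 = ∫ t in (-1 : ℝ)..1, |g t| := by
    apply intervalIntegral.integral_congr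
    intro t ht
    rw [Set.uIcc_of_le h11] at ht
    exact hGe t ht
  set P : ℝ → ℝ := fun y => ∫ t in (-1 : ℝ)..y, φ t with hP
  have hPd : ∀ y, HasDerivAt P (φ y) y := fun y => (hφc.integral_hasStrictDerivAt (-1) y).hasDerivAt
  have hgab : ∀ a ∈ Set.Icc (-1 : ℝ) 1, ∀ b ∈ Set.Icc (-1 : ℝ) 1, a ≤ b →
      |R' b - R' a| ≤ φ b - φ a := by
    intro a ha b hb hab
    have sub : ∀ c ∈ Set.Icc (-1 : ℝ) 1, ∀ d ∈ Set.Icc (-1 : ℝ) 1,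
        IntervalIntegrable g volume c d := by
      intro c hc d hd
      apply hg.mono_set
      rw [Set.uIcc_of_le h11]
      exact Set.uIcc_subset_Icc hc hd
    have m1 : (-1 : ℝ) ∈ Set.Icc (-1 : ℝ) 1 := ⟨le_rfl, h11⟩
    rw [hφs, hR' b hb, hR' a ha, add_sub_add_left_eq_sub,
      intervalIntegral.integral_interval_sub_left (sub _ m1 _ hb) (sub _ m1 _ ha)]
    refine (intervalIntegral.abs_integral_le_integral_abs hab).trans (le_of_eq ?_)
    apply intervalIntegral.integral_congr
    intro t ht
    rw [Set.uIcc_of_le hab] at ht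
    exact (hGe t ⟨ha.1.trans ht.1, ht.2.trans hb.2⟩).symm
  have c1 : ConvexOn ℝ (Set.Icc (-1 : ℝ) 1) (fun t => P t + R t) := by
    apply convex_aux _ (fun t => φ t + R' t)
    · exact fun t ht => (hPd t).hasDerivWithinAt.add (hR t ht)
    · intro a ha b hb hab
      have := (abs_le.1 (hgab a ha b hb hab)).1
      simp only; linarith
  have c2 : ConvexOn ℝ (Set.Icc (-1 : ℝ) 1) (fun t => P t - R t) := by
    apply convex_aux _ (fun t => φ t - R' t)
    · exact fun t ht => (hPd t).hasDerivWithinAt.sub (hR t ht)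
    · intro a ha b hb hab
      have := (abs_le.1 (hgab a ha b hb hab)).2
      simp only; linarith
  have hne : ∀ k ≤ n, node n k ≠ x := fun k hk e => hnode ⟨k, hk, e.symm⟩
  have step : ∀ k < n, |sl R x (node n (k + 1)) - sl R x (node n k)|
      ≤ sl P x (node n (k + 1)) - sl P x (node n k) := by
    intro k hk
    have hx' := Set.Ioo_subset_Icc_self hx
    have s1 := c1.secant_mono hx' (node_mem n k hn hk.le) (node_mem n (k + 1) hn hk)
      (hne k hk.le) (hne _ hk) (node_lt n k hn).le
    have s2 := c2.secant_mono hx' (node_mem n k hn hk.le) (node_mem n (k + 1) hn hk)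
      (hne k hk.le) (hne _ hk) (node_lt n k hn).le
    simp only [add_div, sub_div] at s1 s2
    simp only [sl, sub_div]
    rw [abs_le]; constructor <;> linarith
  have n0 : node n 0 = -1 := by simp [node]
  have nn : node n n = 1 := by
    have hn' : (n : ℝ) ≠ 0 := by positivity
    rw [node]; field_simp; norm_num
  have tele : ∑ k ∈ Finset.range n, (sl P x (node n (k + 1)) - sl P x (node n k))
      = sl P x 1 - sl P x (-1) := by
    rw [Finset.sum_range_sub (fun k => sl P x (node n k)), n0, nn]
  have b1 : sl P x 1 ≤ φ 1 := by
    obtain ⟨c, hc, e⟩ := exists_hasDerivAt_eq_slope P φ hx.2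
      (fun t _ => (hPd t).continuousAt.continuousWithinAt) (fun t _ => hPd t)
    rw [sl, ← e]; exact hφm hc.2.le
  have b2 : 0 ≤ sl P x (-1) := by
    obtain ⟨c, hc, e⟩ := exists_hasDerivAt_eq_slope P φ hx.1
      (fun t _ => (hPd t).continuousAt.continuousWithinAt) (fun t _ => hPd t)
    rw [sl, ← neg_div_neg_eq, neg_sub, neg_sub, ← e, ← hφ0]; exact hφm hc.1.le
  rw [← hφ1]
  calc |Lf R n x| ≤ ∑ k ∈ Finset.range n, |(-1 : ℝ) ^ k * (sl R x (node n (k + 1)) - sl R x (node n k))| :=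
        Finset.abs_sum_le_sum_abs _ _
    _ ≤ ∑ k ∈ Finset.range n, (sl P x (node n (k + 1)) - sl P x (node n k)) := by
        apply Finset.sum_le_sum
        intro k hk
        rw [abs_mul, abs_pow, abs_neg, abs_one, one_pow, one_mul]
        exact step k (Finset.mem_range.1 hk)
    _ ≤ φ 1 := by rw [tele]; linarith

lemma Lf_unif (f : ℝ → ℝ) (hf : AC1 f) (ε : ℝ) (hε : 0 < ε) : ∃ N : ℕ, ∀ n ≥ N, 0 < n →
    ∀ x ∈ Set.Ioo (-1 : ℝ) 1, ¬ isNode n x → |Lf f n x| ≤ ε := by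
  obtain ⟨f', hd, g, hg, hf'⟩ := hf
  obtain ⟨p, hp⟩ := poly_dense g hg (ε / 2) (half_pos hε)
  obtain ⟨q, hq⟩ := poly_antideriv p
  obtain ⟨Q, hQ⟩ := poly_antideriv q
  obtain ⟨C, hC0, hC⟩ := Lf_poly Q
  obtain ⟨N, hN⟩ := exists_nat_gt (C / (ε / 2))
  refine ⟨N, fun n hnN hn x hx hnode => ?_⟩
  have hn' : (0 : ℝ) < n := by exact_mod_cast hn
  have h1 := hC n hn x hx hnode
  have h2 : C / n ≤ ε / 2 := by
    have : (N : ℝ) ≤ n := by exact_mod_cast hnN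
    rw [div_lt_iff₀ (half_pos hε)] at hN
    rw [div_le_iff₀ hn']
    nlinarith
  have hpI : ∀ a b, IntervalIntegrable (fun t => p.eval t) volume a b :=
    fun a b => p.continuous.intervalIntegrable _ _
  have hqd : ∀ t, HasDerivAt (fun t => q.eval t) (p.eval t) t := fun t => by
    rw [← hq]; exact q.hasDerivAt t
  have hQd : ∀ t, HasDerivAt (fun t => Q.eval t) (q.eval t) t := fun t => by
    rw [← hQ]; exact Q.hasDerivAt t
  have h3 := Lf_var (fun t => f t - Q.eval t) (fun t => f' t - q.eval t)
    (fun t => g t - p.eval t)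
    (fun t ht => (hd t ht).sub (hQd t).hasDerivWithinAt) (hg.sub (hpI _ _)) (by
      intro y hy
      have hgy : IntervalIntegrable g volume (-1) y := by
        apply hg.mono_set
        rw [Set.uIcc_of_le (by norm_num : (-1 : ℝ) ≤ 1)]
        exact Set.uIcc_subset_Icc ⟨le_rfl, by norm_num⟩ hy
      rw [intervalIntegral.integral_sub hgy (hpI _ _), hf' y hy,
        intervalIntegral.integral_eq_sub_of_hasDerivAt (fun t _ => hqd t) (hpI _ _)]
      ring) n hn x hx hnode
  have e : Lf f n x = Lf (fun t => f t - Q.eval t) n x + Lf (fun t => Q.eval t) n x := by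
    rw [← Lf_add]; simp
  rw [e]
  refine (abs_add_le _ _).trans ?_
  linarith

end


/-- for `f ∈ AC¹` and an odd sequence `(n_j)`,
`n_j · sup_{x ∈ (-1,1) not a node} |B_{n_j}(f,x) - f(x) - O(f,x)/D_{n_j}(x)| → 0`. -/
theorem statement8 (f : ℝ → ℝ) (hf : AC1 f) (n : ℕ → ℕ) (hmono : StrictMono n)
    (hodd : ∀ j, Odd (n j) ∧ 0 < n j) :
    Filter.Tendsto
      (fun j : ℕ => (n j : ℝ) *
        ⨆ x : {x : ℝ // x ∈ Set.Ioo (-1 : ℝ) 1 ∧ ¬ isNode (n j) x},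
          |berrut f (n j) (x : ℝ) - f (x : ℝ) - Ofun f (x : ℝ) / Dden (n j) (x : ℝ)|)
      Filter.atTop (nhds 0) := by
  rw [Metric.tendsto_atTop]
  intro ε hε
  obtain ⟨N, hN⟩ := Lf_unif f hf (ε / 4) (by positivity)
  refine ⟨N, fun j hj => ?_⟩
  have hn := (hodd j).2
  have hn' : (0 : ℝ) < n j := by exact_mod_cast hn
  have hNj : n j ≥ N := hj.trans (hmono.id_le j)
  have h0 : 0 ≤ ⨆ x : {x : ℝ // x ∈ Set.Ioo (-1 : ℝ) 1 ∧ ¬ isNode (n j) x},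
      |berrut f (n j) (x : ℝ) - f (x : ℝ) - Ofun f (x : ℝ) / Dden (n j) (x : ℝ)| :=
    Real.iSup_nonneg fun _ => abs_nonneg _
  have h1 : ⨆ x : {x : ℝ // x ∈ Set.Ioo (-1 : ℝ) 1 ∧ ¬ isNode (n j) x},
      |berrut f (n j) (x : ℝ) - f (x : ℝ) - Ofun f (x : ℝ) / Dden (n j) (x : ℝ)|
      ≤ (ε / 2) / n j := by
    apply Real.iSup_le _ (by positivity)
    rintro ⟨x, hx, hnode⟩
    have hD := Dden_lower (n j) hn x hx hnode
    have hDpos : 0 < |Dden (n j) x| := lt_of_lt_of_le (by positivity) hD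
    have hD0 : Dden (n j) x ≠ 0 := abs_pos.1 hDpos
    have e : berrut f (n j) x - f x - Ofun f x / Dden (n j) x
        = (1 / 2) * Lf f (n j) x / Dden (n j) x := by
      rw [← num_identity f (n j) hn (hodd j).1 x hnode, berrut, if_neg hnode]
      field_simp
    have hL := hN (n j) hNj hn x hx hnode
    simp only
    rw [e, abs_div, abs_mul, abs_of_pos (by norm_num : (0 : ℝ) < 1 / 2)]
    calc 1 / 2 * |Lf f (n j) x| / |Dden (n j) x| ≤ 1 / 2 * (ε / 4) / (n j / 4) := by gcongr
      _ = (ε / 2) / n j := by field_simp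
  rw [Real.dist_eq, sub_zero, abs_of_nonneg (mul_nonneg hn'.le h0)]
  calc _ ≤ (n j : ℝ) * ((ε / 2) / n j) := by gcongr
    _ = ε / 2 := by field_simp
    _ < ε := by linarith
end

section
/- Let x ∈ (−1,1) be irrational and let r ∈ {0,1}. (i) For every real number y with |y| ≥ π/2 there exists a strictly increasing sequence (n_j) of positive integers with n_j ≡ r (mod 2) for all j and D_{n_j}(x)/n_j → y as j → ∞. (ii) For each σ ∈ {−1, +1} there exists a strictly increasing sequence (n_j) of positive integers with n_j ≡ r (mod 2) for all j and σ · D_{n_j}(x)/n_j → +∞ as j → ∞. -/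
open Filter Set MeasureTheory

open Filter Topology in
lemma cot_real_tendsto (z : ℝ) (hz : Irrational z) :
    Tendsto (fun N : ℕ => ∑ j ∈ Finset.range N, (1 / (z - (j + 1)) + 1 / (z + (j + 1)))) atTop
      (𝓝 (Real.pi * (Real.cos (Real.pi * z) / Real.sin (Real.pi * z)) - 1 / z)) := by
  have hzc : (z : ℂ) ∈ Complex.integerComplement := by
    rintro ⟨k, hk⟩
    exact (hz.ne_int k) (by exact_mod_cast hk.symm)
  have h := tendsto_logDeriv_euler_cot_sub hzc
  have h2 := (Complex.continuous_re.tendsto _).comp h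
  have e : ((Real.pi : ℂ) * Complex.cot (Real.pi * z) - 1 / z) =
    ((Real.pi * (Real.cos (Real.pi * z) / Real.sin (Real.pi * z)) - 1 / z : ℝ) : ℂ) := by
    push_cast [Complex.cot]; rfl
  rw [e, Complex.ofReal_re] at h2
  refine h2.congr fun N => ?_
  have : (∑ j ∈ Finset.range N, cotTerm (z : ℂ) j) =
     ((∑ j ∈ Finset.range N, (1 / (z - (j + 1)) + 1 / (z + (j + 1))) : ℝ) : ℂ) := by
    push_cast; rfl
  simp only [Function.comp, this, Complex.ofReal_re]

lemma csc_finite (z : ℝ) (N : ℕ) :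
    1 / z + ∑ j ∈ Finset.range (2 * N), (-1 : ℝ) ^ (j + 1) * (1 / (z - (j + 1)) + 1 / (z + (j + 1)))
    = 1 / z + ∑ j ∈ Finset.range N, (1 / (z / 2 - (j + 1)) + 1 / (z / 2 + (j + 1)))
      - ∑ j ∈ Finset.range (2 * N), (1 / (z - (j + 1)) + 1 / (z + (j + 1))) := by
  induction N with
  | zero => simp
  | succ N ih =>
    rw [show 2 * (N + 1) = 2 * N + 1 + 1 by ring]
    simp only [Finset.sum_range_succ]
    have e1 : 1 / (z / 2 - ((N : ℝ) + 1)) = 2 * (1 / (z - (((2 * N + 1 : ℕ) : ℝ) + 1))) := by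
      rw [show z - (((2 * N + 1 : ℕ) : ℝ) + 1) = 2 * (z / 2 - ((N : ℝ) + 1)) by push_cast; ring]
      rw [one_div, one_div, mul_inv]; ring
    have e2 : 1 / (z / 2 + ((N : ℝ) + 1)) = 2 * (1 / (z + (((2 * N + 1 : ℕ) : ℝ) + 1))) := by
      rw [show z + (((2 * N + 1 : ℕ) : ℝ) + 1) = 2 * (z / 2 + ((N : ℝ) + 1)) by push_cast; ring]
      rw [one_div, one_div, mul_inv]; ring
    rw [e1, e2]
    have p1 : (-1 : ℝ) ^ (2 * N + 1) = -1 := by rw [pow_succ, pow_mul]; norm_num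
    have p2 : (-1 : ℝ) ^ (2 * N + 1 + 1) = 1 := by rw [pow_succ, p1]; norm_num
    rw [p1, p2]
    linarith

open Filter Topology in
lemma csc_tendsto (z : ℝ) (hz : Irrational z) :
    Tendsto (fun N : ℕ => 1 / z + ∑ j ∈ Finset.range (2 * N),
      (-1 : ℝ) ^ (j + 1) * (1 / (z - (j + 1)) + 1 / (z + (j + 1)))) atTop
      (𝓝 (Real.pi / Real.sin (Real.pi * z))) := by
  have hz2 : Irrational (z / 2) := by simpa using hz.div_natCast (m := 2) (by norm_num)
  have h1 := cot_real_tendsto _ hz2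
  have h2 := (cot_real_tendsto _ hz).comp (tendsto_id.const_mul_atTop' (show 0 < 2 by norm_num))
  have h3 := (h1.const_add (1 / z)).sub h2
  have hs : Real.sin (Real.pi * z) ≠ 0 := by
    rw [Real.sin_ne_zero_iff]
    intro n hn
    rw [mul_comm] at hn
    exact hz.ne_int n (mul_left_cancel₀ Real.pi_ne_zero hn).symm
  have e : Real.pi / Real.sin (Real.pi * z) =
     1 / z + (Real.pi * (Real.cos (Real.pi * (z / 2)) / Real.sin (Real.pi * (z / 2))) - 1 / (z / 2))
     - (Real.pi * (Real.cos (Real.pi * z) / Real.sin (Real.pi * z)) - 1 / z) := by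
    have hd : Real.pi * z = 2 * (Real.pi * (z / 2)) := by ring
    have hz0 : z ≠ 0 := hz.ne_zero
    rw [hd, Real.sin_two_mul] at hs
    rw [hd, Real.sin_two_mul, Real.cos_two_mul]
    have ha : Real.sin (Real.pi * (z / 2)) ≠ 0 := by intro h; simp [h] at hs
    have hb : Real.cos (Real.pi * (z / 2)) ≠ 0 := by intro h; simp [h] at hs
    generalize Real.sin (Real.pi * (z / 2)) = s at *
    generalize Real.cos (Real.pi * (z / 2)) = c at *
    field_simp
    ring
  rw [e]
  refine h3.congr fun N => ?_
  rw [csc_finite]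
  simp [Function.comp]

lemma alt_bound (N : ℕ) : ∀ a : ℕ → ℝ, Antitone a → (∀ k, 0 ≤ a k) →
    0 ≤ ∑ k ∈ Finset.range N, (-1 : ℝ) ^ k * a k ∧
      ∑ k ∈ Finset.range N, (-1 : ℝ) ^ k * a k ≤ a 0 := by
  induction N with
  | zero => intro a _ h; simpa using h 0
  | succ N ih =>
    intro a ha h
    obtain ⟨h1, h2⟩ := ih (fun k => a (k + 1)) (fun i j hij => ha (by omega)) (fun k => h _)
    have h3 := ha (show 0 ≤ 0 + 1 by norm_num)
    have e : ∑ k ∈ Finset.range (N + 1), (-1 : ℝ) ^ k * a k =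
      a 0 - ∑ k ∈ Finset.range N, (-1 : ℝ) ^ k * a (k + 1) := by
      rw [Finset.sum_range_succ', sub_eq_add_neg, ← Finset.sum_neg_distrib, add_comm]
      simp [pow_succ]
    rw [e]
    constructor <;> linarith

lemma anti_aux (c : ℝ) (hc : 0 < c) : Antitone (fun k : ℕ => 1 / (c + k)) := by
  intro i j hij
  have : (i : ℝ) ≤ j := by exact_mod_cast hij
  have : 0 ≤ (i : ℝ) := by positivity
  exact one_div_le_one_div_of_le (by linarith) (by linarith)

lemma split_sum (z : ℝ) (n M : ℕ) :
    1 / z + ∑ j ∈ Finset.range (n + M), (-1 : ℝ) ^ (j + 1) * (1 / (z - (j + 1)) + 1 / (z + (j + 1)))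
    = ∑ k ∈ Finset.range (n + 1), (-1 : ℝ) ^ k / (z - k)
      - ∑ j ∈ Finset.range (n + M), (-1 : ℝ) ^ j * (1 / (z + 1 + j))
      + (-1) ^ n * ∑ j ∈ Finset.range M, (-1 : ℝ) ^ j * (1 / ((n + 1 - z) + j)) := by
  have e : ∀ j : ℕ, (-1 : ℝ) ^ (j + 1) * (1 / (z - (j + 1)) + 1 / (z + (j + 1))) =
    (-1 : ℝ) ^ (j + 1) / (z - ((j + 1 : ℕ) : ℝ)) - (-1 : ℝ) ^ j * (1 / (z + 1 + j)) := by
    intro j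
    rw [show z + ((j : ℝ) + 1) = z + 1 + j by ring]
    push_cast
    ring
  simp only [e, Finset.sum_sub_distrib]
  rw [Finset.sum_range_succ' _ n]
  rw [Finset.sum_range_add (fun j : ℕ => (-1 : ℝ) ^ (j + 1) / (z - ((j + 1 : ℕ) : ℝ))), Finset.mul_sum]
  have e2 : ∀ j : ℕ, (-1 : ℝ) ^ (n + j + 1) / (z - ((n + j + 1 : ℕ) : ℝ)) =
     (-1) ^ n * ((-1 : ℝ) ^ j * (1 / ((n + 1 - z) + j))) := by
    intro j
    rw [show z - ((n + j + 1 : ℕ) : ℝ) = - ((n + 1 - z) + j) by push_cast; ring, div_neg]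
    ring
  simp only [e2]
  simp
  ring

open Filter Topology in
lemma csc_approx (z : ℝ) (hz : Irrational z) (n : ℕ) (h0 : 0 < z) (h1 : z < n) :
    |∑ k ∈ Finset.range (n + 1), (-1 : ℝ) ^ k / (z - k) - Real.pi / Real.sin (Real.pi * z)|
      ≤ 1 / (z + 1) + 1 / (n + 1 - z) := by
  have h := ((csc_tendsto z hz).const_sub
    (∑ k ∈ Finset.range (n + 1), (-1 : ℝ) ^ k / (z - k))).abs
  refine le_of_tendsto h ?_
  filter_upwards [eventually_ge_atTop n] with N hN
  obtain ⟨M, hM⟩ : ∃ M, 2 * N = n + M := ⟨2 * N - n, by omega⟩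
  rw [hM, split_sum]
  obtain ⟨a1, a2⟩ := alt_bound (n + M) _ (anti_aux (z + 1) (by linarith))
    (fun k => by positivity)
  have hp : (0 : ℝ) < n + 1 - z := by linarith
  obtain ⟨b1, b2⟩ := alt_bound M _ (anti_aux (n + 1 - z) hp)
    (fun k => by positivity)
  simp only [Nat.cast_zero, add_zero] at a2 b2
  rcases neg_one_pow_eq_or ℝ n with h | h <;> rw [h, abs_le] <;> constructor <;> linarith

lemma Dden_approx (x : ℝ) (hx : x ∈ Set.Ioo (-1 : ℝ) 1) (hirr : Irrational x) (n : ℕ) (hn : 0 < n) :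
    |Dden n x / n - Real.pi / 2 / Real.sin (Real.pi * (n * ((x + 1) / 2)))|
      ≤ (2 / (x + 1) + 2 / (1 - x)) / n := by
  obtain ⟨hx1, hx2⟩ := hx
  have hn' : (0 : ℝ) < n := by exact_mod_cast hn
  have hi : Irrational (n * ((x + 1) / 2)) := by
    have := ((hirr.add_natCast 1).div_natCast (m := 2) (by norm_num)).natCast_mul (m := n) (by omega)
    simpa using this
  have p1 : 0 < x + 1 := by linarith
  have p2 : 0 < 1 - x := by linarith
  have h := csc_approx _ hi n (by positivity) (by nlinarith)
  have e : Dden n x / n =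
      1 / 2 * ∑ k ∈ Finset.range (n + 1), (-1 : ℝ) ^ k / (n * ((x + 1) / 2) - k) := by
    rw [Dden, Finset.sum_div, Finset.mul_sum]
    refine Finset.sum_congr rfl fun k _ => ?_
    rw [div_div, node, show (x - (2 * k / n - 1)) * (n : ℝ) = 2 * (n * ((x + 1) / 2) - k) by
      field_simp; ring]
    rw [← div_div]; ring
  rw [e, show Real.pi / 2 / Real.sin (Real.pi * (n * ((x + 1) / 2))) =
    1 / 2 * (Real.pi / Real.sin (Real.pi * (n * ((x + 1) / 2)))) by ring, ← mul_sub, abs_mul]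
  have b1 : 1 / (n * ((x + 1) / 2) + 1) ≤ 2 / (x + 1) / n := by
    rw [div_div, div_le_div_iff₀ (by positivity) (by positivity)]; nlinarith
  have b2 : 1 / (n + 1 - n * ((x + 1) / 2)) ≤ 2 / (1 - x) / n := by
    have : (n : ℝ) + 1 - n * ((x + 1) / 2) = n * ((1 - x) / 2) + 1 := by ring
    rw [this, div_div, div_le_div_iff₀ (by positivity) (by positivity)]; nlinarith
  rw [add_div (2 / (x + 1)), abs_of_pos (by norm_num : (0 : ℝ) < 1 / 2)]
  have := abs_nonneg (∑ k ∈ Finset.range (n + 1), (-1 : ℝ) ^ k / (n * ((x + 1) / 2) - k) -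
    Real.pi / Real.sin (Real.pi * (n * ((x + 1) / 2))))
  linarith

open Filter Topology in
lemma angle_seq (α : ℝ) (hα : Irrational α) (r : ℕ) (θ : ℝ) :
    ∃ m : ℕ → ℕ, StrictMono m ∧
      Tendsto (fun j => Real.sin (Real.pi * (((2 * m j + r : ℕ) : ℝ) * α))) atTop
        (𝓝 (Real.sin θ)) := by
  haveI : Fact (0 < 2 * Real.pi) := ⟨by positivity⟩
  have hd : DenseRange ((· • ((2 * Real.pi * α : ℝ) : AddCircle (2 * Real.pi))) : ℤ → _) := by
    rw [AddCircle.denseRange_zsmul_coe_iff]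
    rwa [mul_div_cancel_left₀ _ (by positivity)]
  have hc := ((mapClusterPt_atTop_nsmul_tfae
    ((θ - Real.pi * r * α : ℝ) : AddCircle (2 * Real.pi))
    ((2 * Real.pi * α : ℝ) : AddCircle (2 * Real.pi))).out 0 3).2 (hd _)
  obtain ⟨m, hm, hlim⟩ := TopologicalSpace.FirstCountableTopology.tendsto_subseq hc
  refine ⟨m, hm, ?_⟩
  have hcont : Continuous (fun a : AddCircle (2 * Real.pi) =>
    Real.Angle.sin ((a + ((Real.pi * r * α : ℝ) : AddCircle (2 * Real.pi)) : AddCircle (2 * Real.pi)))) :=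
    Real.Angle.continuous_sin.comp (continuous_id.add continuous_const)
  have h := (hcont.tendsto _).comp hlim
  have e0 : (((θ - Real.pi * r * α : ℝ) : AddCircle (2 * Real.pi)) +
     ((Real.pi * r * α : ℝ) : AddCircle (2 * Real.pi))) = ((θ : ℝ) : AddCircle (2 * Real.pi)) := by
    rw [← AddCircle.coe_add]; congr 1; ring
  rw [e0] at h
  refine h.congr fun j => ?_
  simp only [Function.comp]
  rw [← AddCircle.coe_nsmul, ← AddCircle.coe_add]
  refine (Real.Angle.sin_coe _).trans ?_
  congr 1
  push_cast [nsmul_eq_mul]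
  ring

open Filter Topology in
lemma part_one (x : ℝ) (hx : x ∈ Set.Ioo (-1 : ℝ) 1) (hirr : Irrational x)
    (r : ℕ) (hr : r = 0 ∨ r = 1) (y : ℝ) (hy : Real.pi / 2 ≤ |y|) :
      ∃ n : ℕ → ℕ, StrictMono n ∧ (∀ j, 0 < n j ∧ n j % 2 = r) ∧
        Filter.Tendsto (fun j : ℕ => Dden (n j) x / (n j : ℝ))
          Filter.atTop (nhds y) := by
  have hα : Irrational ((x + 1) / 2) := by
    simpa using (hirr.add_natCast 1).div_natCast (m := 2) (by norm_num)
  have hpi := Real.pi_pos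
  have hy0 : y ≠ 0 := by
    rintro rfl; simp at hy; linarith
  have hs : |Real.pi / 2 / y| ≤ 1 := by
    rw [abs_div, abs_of_pos (by positivity : 0 < Real.pi / 2)]
    exact div_le_one_of_le₀ hy (abs_nonneg _)
  rw [abs_le] at hs
  obtain ⟨m, hm, hlim⟩ := angle_seq _ hα r (Real.arcsin (Real.pi / 2 / y))
  rw [Real.sin_arcsin hs.1 hs.2] at hlim
  refine ⟨fun j => 2 * m (j + 1) + r, ?_, ?_, ?_⟩
  · intro i j hij
    have := hm (show i + 1 < j + 1 by omega)
    simp only; omega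
  · intro j
    have := hm.le_apply (x := j + 1)
    simp only; omega
  · have h1 : Tendsto (fun j => Real.pi / 2 /
        Real.sin (Real.pi * (((2 * m (j + 1) + r : ℕ) : ℝ) * ((x + 1) / 2)))) atTop (𝓝 y) := by
      have := (tendsto_const_nhds (x := Real.pi / 2)).div
        (hlim.comp (tendsto_add_atTop_nat 1)) (by positivity)
      rw [div_div_cancel₀ (by positivity)] at this
      exact this
    have hN : Tendsto (fun j => 2 * m (j + 1) + r) atTop atTop := by
      refine tendsto_atTop_mono (fun j => ?_) tendsto_id
      have := hm.le_apply (x := j + 1)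
      simp only [id]; omega
    have h2 : Tendsto (fun j => Dden (2 * m (j + 1) + r) x / ((2 * m (j + 1) + r : ℕ) : ℝ)
        - Real.pi / 2 /
        Real.sin (Real.pi * (((2 * m (j + 1) + r : ℕ) : ℝ) * ((x + 1) / 2)))) atTop (𝓝 0) := by
      refine squeeze_zero_norm (fun j => ?_)
        ((tendsto_const_div_atTop_nhds_zero_nat (2 / (x + 1) + 2 / (1 - x))).comp hN)
      rw [Real.norm_eq_abs]
      refine Dden_approx x hx hirr _ ?_
      have := hm.le_apply (x := j + 1)
      omega
    simpa using h2.add h1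

/-- for irrational `x ∈ (-1,1)` and a prescribed parity `r`,
(i) every `y` with `|y| ≥ π/2` is a limit of `D_{n_j}(x)/n_j` along a sequence of
parity `r`; (ii) `σ D_{n_j}(x)/n_j → +∞` is attained likewise, for `σ = ±1`. -/
theorem statement15 (x : ℝ) (hx : x ∈ Set.Ioo (-1 : ℝ) 1) (hirr : Irrational x)
    (r : ℕ) (hr : r = 0 ∨ r = 1) :
    (∀ y : ℝ, Real.pi / 2 ≤ |y| →
      ∃ n : ℕ → ℕ, StrictMono n ∧ (∀ j, 0 < n j ∧ n j % 2 = r) ∧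
        Filter.Tendsto (fun j : ℕ => Dden (n j) x / (n j : ℝ))
          Filter.atTop (nhds y)) ∧
    (∀ σ : ℝ, σ = -1 ∨ σ = 1 →
      ∃ n : ℕ → ℕ, StrictMono n ∧ (∀ j, 0 < n j ∧ n j % 2 = r) ∧
        Filter.Tendsto (fun j : ℕ => σ * Dden (n j) x / (n j : ℝ))
          Filter.atTop Filter.atTop) := by
  refine ⟨fun y hy => part_one x hx hirr r hr y hy, fun σ hσ => ?_⟩
  have key : ∀ j : ℕ, ∃ᶠ n in Filter.atTop,
      (0 < n ∧ n % 2 = r) ∧ (j : ℝ) ≤ σ * Dden n x / (n : ℝ) := by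
    intro j
    have hpi := Real.pi_le_four
    have hs2 : σ * σ = 1 := by rcases hσ with h | h <;> rw [h] <;> norm_num
    have habs : |σ| = 1 := by rcases hσ with h | h <;> rw [h] <;> norm_num
    obtain ⟨n, hn, hn2, hlim⟩ := part_one x hx hirr r hr (σ * (j + 2)) (by
      rw [abs_mul, habs, abs_of_nonneg (by positivity)]
      have : (0 : ℝ) ≤ j := by positivity
      linarith)
    have h2 := hlim.const_mul σ
    rw [← mul_assoc, hs2, one_mul] at h2
    have h3 := h2.eventually (lt_mem_nhds (show (j : ℝ) < j + 2 by linarith))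
    refine hn.tendsto_atTop.frequently (Filter.Eventually.frequently ?_)
    filter_upwards [h3] with i hi
    refine ⟨hn2 i, ?_⟩
    rw [mul_div_assoc]
    exact hi.le
  obtain ⟨n, hn, hp⟩ := Filter.extraction_forall_of_frequently key
  exact ⟨n, hn, fun j => (hp j).1,
    Filter.tendsto_atTop_mono (fun j => (hp j).2) tendsto_natCast_atTop_atTop⟩
end
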